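/- Let A=(Q,Σ,δ,ρ) be a connected bireversible Mealy automaton whose orbit tree o(A) has no active self-liftable branch, and let j be a jungle tree of o(A) with trunk of length n. The relation ∼ (defined on stems by: u ∼ v if there exists s∈Q* such that u·s·v is a j-word and ρ_{u·s} is the identity on Σ*) is an equivalence relation on the set of stems of j. -/

import Mathlib

open List

variable {Q A : Type*}

/-- Action of a state on words over the alphabet:
`ρ_x(i·s) = ρ_x(i) · ρ_{δ_i(x)}(s)`. -/
def mrho (d : A → Q → Q) (r : Q → A → A) : Q → List A → List A
  | _, [] => []
  | x, i :: s => r x i :: mrho d r (d i x) s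

/-- Action of a word of states: `ρ_{x₁⋯x_m} = ρ_{x_m} ∘ ⋯ ∘ ρ_{x₁}`. -/
def mrhoW (d : A → Q → Q) (r : Q → A → A) : List Q → List A → List A
  | [], s => s
  | x :: u, s => mrhoW d r u (mrho d r x s)

/-- Dual action of a letter on words of states:
`δ_i(x·u) = δ_i(x) · δ_{ρ_x(i)}(u)`. -/
def mdel (d : A → Q → Q) (r : Q → A → A) : A → List Q → List Q
  | _, [] => []
  | i, x :: u => d i x :: mdel d r (r x i) u

/-- Action of a word of letters: `δ_{s₁⋯s_m} = δ_{s_m} ∘ ⋯ ∘ δ_{s₁}`. -/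
def mdelW (d : A → Q → Q) (r : Q → A → A) : List A → List Q → List Q
  | [], u => u
  | i :: s, u => mdelW d r s (mdel d r i u)

/-- Connected component (orbit under the dual action) of a word of states. -/
def mOrbit (d : A → Q → Q) (r : Q → A → A) (u : List Q) : Set (List Q) :=
  { v | ∃ s : List A, mdelW d r s u = v }

/-- The Mealy automaton is invertible. -/
def MInvertible (r : Q → A → A) : Prop := ∀ x : Q, Function.Bijective (r x)

/-- The Mealy automaton is reversible. -/
def MReversible (d : A → Q → Q) : Prop := ∀ i : A, Function.Bijective (d i)

/-- The Mealy automaton is connected. -/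
def MConnected (d : A → Q → Q) (r : Q → A → A) : Prop :=
  ∀ x y : Q, ∃ s : List A, mdelW d r s [x] = [y]

/-- The Mealy automaton is bireversible: invertible, reversible, and for each output
letter `j`, the map sending `x` to `δ_i(x)` (where `i` is the unique letter with
`ρ_x(i) = j`) is a permutation of the (finite) stateset, encoded as injectivity. -/
def MBireversible (d : A → Q → Q) (r : Q → A → A) : Prop :=
  MInvertible r ∧ MReversible d ∧
    ∀ (x y : Q) (i i' : A), r x i = r y i' → d i x = d i' y → x = y

/-- The edge of the orbit tree whose bottom is the component of `e` is liftable
to the edge whose bottom is the component of `f`: every word of `⊥(e)` admits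
some word of `⊥(f)` as a suffix. -/
def EdgeLiftable (d : A → Q → Q) (r : Q → A → A) (e f : List Q) : Prop :=
  ∀ v ∈ mOrbit d r e, ∃ v' ∈ mOrbit d r f, v' <:+ v

/-- Prefix of length `m` of the infinite word `α : ℕ → Q`. -/
def branchPrefix (α : ℕ → Q) (m : ℕ) : List Q := (List.range m).map α

/-- The orbit tree admits an active self-liftable branch: a branch, represented by
an infinite word `α`, which is `k`-self-liftable for some `k ≥ 1` (every edge at
level `j + k` of the branch is liftable to the edge at level `j`), and active
(its label sequence is not eventually `1`, i.e. the sizes of the components of the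
prefixes do not become eventually constant). -/
def HasActiveSelfLiftableBranch (d : A → Q → Q) (r : Q → A → A) : Prop :=
  ∃ (α : ℕ → Q) (k : ℕ), 1 ≤ k ∧
    (∀ j : ℕ, 1 ≤ j → EdgeLiftable d r (branchPrefix α (j + k)) (branchPrefix α j)) ∧
    ∀ N : ℕ, ∃ m : ℕ, N ≤ m ∧
      (mOrbit d r (branchPrefix α (m + 1))).ncard ≠ (mOrbit d r (branchPrefix α m)).ncard

/-- `t` represents the trunk of a jungle tree: a non-empty finite initial
`1`-self-liftable path (each edge of the trunk is liftable to the preceding one)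
such that the bottom of the trunk has at least two legitimate children
(children liftable to the last trunk edge), and every legitimate child has label `1`. -/
def IsJungleTrunk (d : A → Q → Q) (r : Q → A → A) (t : List Q) : Prop :=
  t ≠ [] ∧
  (∀ j : ℕ, 2 ≤ j → j ≤ t.length → EdgeLiftable d r (t.take j) (t.take (j - 1))) ∧
  (∃ x y : Q, mOrbit d r (t ++ [x]) ≠ mOrbit d r (t ++ [y]) ∧
    EdgeLiftable d r (t ++ [x]) t ∧ EdgeLiftable d r (t ++ [y]) t) ∧
  ∀ x : Q, EdgeLiftable d r (t ++ [x]) t →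
    (mOrbit d r (t ++ [x])).ncard = (mOrbit d r t).ncard

/-- `u` is a `j`-word for the jungle tree with trunk `t`: the sequence of connected
components of the prefixes of `u` is an initial path of the jungle tree, i.e. the
component of each prefix of length `i ≤ |t|` coincides with the component of the
corresponding trunk prefix, and each deeper edge is liftable to the last trunk edge. -/
def IsJWord (d : A → Q → Q) (r : Q → A → A) (t u : List Q) : Prop :=
  (∀ i : ℕ, i ≤ u.length → i ≤ t.length → u.take i ∈ mOrbit d r (t.take i)) ∧
  ∀ l : ℕ, t.length ≤ l → l < u.length → EdgeLiftable d r (u.take (l + 1)) t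

/-- A stem is a `j`-word whose length is the length of the trunk. -/
def IsStem (d : A → Q → Q) (r : Q → A → A) (t u : List Q) : Prop :=
  IsJWord d r t u ∧ u.length = t.length

/-- A cyclic `j`-word is a finite word all of whose powers are `j`-words. -/
def IsCyclicJWord (d : A → Q → Q) (r : Q → A → A) (t u : List Q) : Prop :=
  ∀ k : ℕ, IsJWord d r t (List.flatten (List.replicate k u))

/-- The relation `∼` on stems: `u ∼ v` whenever there is `s` such that `u·s·v` is a
`j`-word and `ρ_{u·s}` acts like the identity on `Σ*`. -/
def StemEquiv (d : A → Q → Q) (r : Q → A → A) (t u v : List Q) : Prop :=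
  ∃ s : List Q, IsJWord d r t (u ++ s ++ v) ∧ ∀ w : List A, mrhoW d r (u ++ s) w = w

section helpers
variable (d : A → Q → Q) (r : Q → A → A)

def hdq (s : List A) (x : Q) : Q := s.foldl (fun x i => d i x) x

def hout (u : List Q) (i : A) : A := u.foldl (fun i x => r x i) i

lemma h_cons (s : List A) (x : Q) (u : List Q) :
    mdelW d r s (x :: u) = hdq d s x :: mdelW d r (mrho d r x s) u := by
  induction s generalizing x u with
  | nil => simp [mdelW, mrho, hdq]
  | cons i s ih => simp [mdelW, mrho, hdq, mdel, ih]

lemma h_nil (s : List A) : mdelW d r s [] = [] := by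
  induction s with
  | nil => rfl
  | cons i s ih => simpa [mdelW, mdel] using ih

lemma h_append (s : List A) (u v : List Q) :
    mdelW d r s (u ++ v) = mdelW d r s u ++ mdelW d r (mrhoW d r u s) v := by
  induction u generalizing s with
  | nil => simp [h_nil, mrhoW]
  | cons x u ih => simp [h_cons, ih, mrhoW]

lemma h_len (s : List A) (u : List Q) : (mdelW d r s u).length = u.length := by
  induction u generalizing s with
  | nil => simp [h_nil]
  | cons x u ih => simp [h_cons, ih]

lemma h_comp (s s' : List A) (u : List Q) :
    mdelW d r (s ++ s') u = mdelW d r s' (mdelW d r s u) := by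
  induction s generalizing u with
  | nil => rfl
  | cons i s ih => simp [mdelW, ih]

lemma h_take (s : List A) (u : List Q) (i : ℕ) :
    (mdelW d r s u).take i = mdelW d r s (u.take i) := by
  conv_lhs => rw [← List.take_append_drop i u, h_append]
  by_cases h : i ≤ u.length
  · rw [List.take_append_of_le_length (by rw [h_len, List.length_take]; omega)]
    rw [List.take_of_length_le]; rw [h_len, List.length_take]; omega
  · rw [List.drop_of_length_le (by omega), h_nil, List.append_nil,
      List.take_of_length_le]; rw [h_len, List.length_take]; omega

lemma hr_append (u v : List Q) (w : List A) :
    mrhoW d r (u ++ v) w = mrhoW d r v (mrhoW d r u w) := by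
  induction u generalizing w with
  | nil => rfl
  | cons x u ih => simp [mrhoW, ih]

lemma hr_nil (u : List Q) : mrhoW d r u [] = [] := by
  induction u with
  | nil => rfl
  | cons x u ih => simpa [mrhoW, mrho] using ih

lemma hr_cons (u : List Q) (i : A) (w : List A) :
    mrhoW d r u (i :: w) = hout r u i :: mrhoW d r (mdel d r i u) w := by
  induction u generalizing i w with
  | nil => rfl
  | cons x u ih => simp [mrhoW, mrho, mdel, hout, ih]

lemma hr_inj (hi : MInvertible r) (u : List Q) : Function.Injective (mrhoW d r u) := by
  have h1 : ∀ (w w' : List A) (x : Q), mrho d r x w = mrho d r x w' → w = w' := by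
    intro w
    induction w with
    | nil => intro w' x h; cases w' <;> simp [mrho] at h ⊢
    | cons i w ih =>
      intro w' x h
      cases w' with
      | nil => simp [mrho] at h
      | cons j w' =>
        simp only [mrho, List.cons.injEq] at h
        have := (hi x).1 h.1
        subst this
        rw [ih _ _ h.2]
  induction u with
  | nil => intro a b h; exact h
  | cons x u ih => intro a b h; exact h1 _ _ x (ih h)

lemma hr_surj (hi : MInvertible r) (x : Q) (w : List A) : ∃ w', mrho d r x w' = w := by
  induction w generalizing x with
  | nil => exact ⟨[], rfl⟩
  | cons j w ih =>
    obtain ⟨i, hj⟩ := (hi x).2 j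
    obtain ⟨w', hw⟩ := ih (d i x)
    exact ⟨i :: w', by simp [mrho, hj, hw]⟩

lemma hd_inj (hd : MReversible d) (i : A) : Function.Injective (mdel d r i) := by
  intro u v h
  induction u generalizing i v with
  | nil => cases v <;> simp [mdel] at h ⊢
  | cons x u ih =>
    cases v with
    | nil => simp [mdel] at h
    | cons y v =>
      simp only [mdel, List.cons.injEq] at h
      have := (hd i).1 h.1
      subst this
      rw [ih _ h.2]

lemma h_single (i : A) (k : ℕ) (u : List Q) :
    mdelW d r (List.replicate k i) u = (mdel d r i)^[k] u := by
  induction k generalizing u with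
  | zero => rfl
  | succ k ih => simp [List.replicate_succ, mdelW, ih]

lemma h_inv [Finite Q] (hd : MReversible d) (s : List A) (u : List Q) :
    ∃ s', mdelW d r s' (mdelW d r s u) = u := by
  have key : ∀ (i : A) (u : List Q), ∃ s', mdelW d r s' (mdel d r i u) = u := by
    intro i u
    have hl : ∀ v : List Q, (mdel d r i v).length = v.length := fun v => h_len d r [i] v
    have : Finite {v : List Q // v.length = u.length} := List.finite_length_eq Q u.length
    let f : {v : List Q // v.length = u.length} → {v : List Q // v.length = u.length} :=
      fun v => ⟨mdel d r i v.1, by rw [hl, v.2]⟩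
    have hf : Function.Injective f := by
      intro a b h
      exact Subtype.ext (hd_inj d r hd i (congrArg Subtype.val h))
    obtain ⟨k, hk, hp⟩ := hf.mem_periodicPts ⟨u, rfl⟩
    obtain ⟨k, rfl⟩ : ∃ m, k = m + 1 := ⟨k - 1, by omega⟩
    have hit : ∀ (m : ℕ) (v), (f^[m] v).1 = (mdel d r i)^[m] v.1 := by
      intro m
      induction m with
      | zero => intro v; rfl
      | succ m ih => intro v; simp [ih, f]
    refine ⟨List.replicate k i, ?_⟩
    rw [h_single]
    have h2 := congrArg Subtype.val hp
    rw [hit] at h2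
    exact h2
  induction s generalizing u with
  | nil => exact ⟨[], rfl⟩
  | cons i s ih =>
    obtain ⟨s1, h1⟩ := ih (mdel d r i u)
    obtain ⟨s2, h2⟩ := key i u
    refine ⟨s1 ++ s2, ?_⟩
    rw [h_comp]
    simp only [mdelW]
    rw [h1, h2]

lemma o_self (u : List Q) : u ∈ mOrbit d r u := ⟨[], rfl⟩

lemma o_trans {u v w : List Q} (h : v ∈ mOrbit d r u) (h' : w ∈ mOrbit d r v) :
    w ∈ mOrbit d r u := by
  obtain ⟨s, rfl⟩ := h
  obtain ⟨s', rfl⟩ := h'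
  exact ⟨s ++ s', h_comp d r s s' u⟩

lemma o_symm [Finite Q] (hd : MReversible d) {u v : List Q} (h : v ∈ mOrbit d r u) :
    u ∈ mOrbit d r v := by
  obtain ⟨s, rfl⟩ := h
  exact h_inv d r hd s u

lemma o_eq [Finite Q] (hd : MReversible d) {u v : List Q} (h : v ∈ mOrbit d r u) :
    mOrbit d r u = mOrbit d r v := by
  ext w
  exact ⟨fun h' => o_trans d r (o_symm d r hd h) h', fun h' => o_trans d r h h'⟩

lemma o_len {u v : List Q} (h : v ∈ mOrbit d r u) : v.length = u.length := by
  obtain ⟨s, rfl⟩ := h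
  exact h_len d r s u

lemma o_fin [Finite Q] (u : List Q) : (mOrbit d r u).Finite :=
  (List.finite_length_eq Q u.length).subset (fun _ h => o_len d r h)

/-- all factors of the trunk length are stems -/
def HJ (t w : List Q) : Prop :=
  ∀ f, f <:+: w → f.length = t.length → f ∈ mOrbit d r t

variable {d r}

lemma HJ.mono {t w w' : List Q} (h : HJ d r t w) (h' : w' <:+: w) : HJ d r t w' :=
  fun f hf hl => h f (hf.trans h') hl

lemma HJ.glue {t p v q : List Q} (hv : v.length = t.length) (h1 : HJ d r t (p ++ v))
    (h2 : HJ d r t (v ++ q)) : HJ d r t (p ++ v ++ q) := by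
  rintro f ⟨a, b, hab⟩ hl
  by_cases h : a.length ≤ p.length
  · apply h1 f _ hl
    have : a ++ f <+: p ++ v := by
      apply List.prefix_of_prefix_length_le (l₃ := p ++ v ++ q)
      · exact ⟨b, hab⟩
      · exact List.prefix_append _ _
      · simp; omega
    exact (List.suffix_append a f).isInfix.trans this.isInfix
  · apply h2 f _ hl
    have : f ++ b <:+ v ++ q := by
      apply List.suffix_of_suffix_length_le (l₃ := p ++ v ++ q)
      · exact ⟨a, by simpa using hab⟩
      · exact ⟨p, by simp⟩
      · have := congrArg List.length hab
        simp at this ⊢; omega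
    exact (List.prefix_append f b).isInfix.trans this.isInfix

lemma HJ.of_mem {t u : List Q} (h : u ∈ mOrbit d r t) : HJ d r t u := by
  intro f hf hl
  rw [hf.eq_of_length (by rw [hl, o_len d r h])]
  exact h

lemma el_iff {t w : List Q} (hl : t.length ≤ w.length) :
    EdgeLiftable d r w t ↔ w.drop (w.length - t.length) ∈ mOrbit d r t := by
  constructor
  · intro h
    obtain ⟨v, hv, hs⟩ := h w (o_self d r w)
    rw [List.suffix_iff_eq_drop.1 hs] at hv
    have := o_len d r hv
    have e : w.length - v.length = w.length - t.length := by
      rw [List.suffix_iff_eq_drop.1 hs, List.length_drop]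
      simp at this; omega
    rwa [e] at hv
  · rintro h v ⟨s, rfl⟩
    have e := h_append d r s (w.take (w.length - t.length)) (w.drop (w.length - t.length))
    rw [List.take_append_drop] at e
    rw [e]
    exact ⟨_, o_trans d r h ⟨_, rfl⟩, List.suffix_append _ _⟩

lemma jword_iff {t w : List Q} (hl : t.length ≤ w.length) :
    IsJWord d r t w ↔ HJ d r t w := by
  constructor
  · rintro ⟨h1, h2⟩ f ⟨a, b, rfl⟩ hf
    rcases a with _ | ⟨x, a⟩
    · have := h1 t.length hl le_rfl
      rw [List.take_length, ← hf] at this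
      simpa using this
    · have := h2 (a.length + f.length) (by omega) (by simp)
      have e : ((x :: a) ++ f ++ b).take (a.length + f.length + 1) = (x :: a) ++ f := by
        rw [List.take_append_of_le_length (by simp [Nat.add_right_comm]), List.take_of_length_le (by simp [Nat.add_right_comm])]
      rw [e, el_iff (by simp; omega)] at this
      rwa [List.drop_left' (by simp; omega)] at this
  · intro h
    constructor
    · intro i hi hit
      have h0 : w.take t.length ∈ mOrbit d r t :=
        h _ (List.take_prefix _ _).isInfix (by simp; omega)
      obtain ⟨s, hs⟩ := h0
      refine ⟨s, ?_⟩
      rw [← h_take, hs, List.take_take, min_eq_left hit]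
    · intro l h1 h2
      rw [el_iff (by simp; omega)]
      apply h
      · exact (List.drop_suffix _ _).isInfix.trans (List.take_prefix _ _).isInfix
      · simp; omega

lemma det_one [Finite Q] (hd : MReversible d) {t u : List Q} {x : Q} (ht : IsJungleTrunk d r t)
    (hu : u.length = t.length) (h : HJ d r t (u ++ [x])) {s s' : List A}
    (hs : mdelW d r s u = mdelW d r s' u) :
    mdelW d r s (u ++ [x]) = mdelW d r s' (u ++ [x]) := by
  have huO : u ∈ mOrbit d r t := h u (List.prefix_append _ _).isInfix hu
  obtain ⟨s1, h1⟩ := o_symm d r hd huO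
  obtain ⟨x0, hx0⟩ : ∃ x0, mdelW d r s1 (u ++ [x]) = t ++ [x0] := by
    rw [h_append, h1, h_cons, h_nil]
    exact ⟨_, rfl⟩
  have ho : mOrbit d r (u ++ [x]) = mOrbit d r (t ++ [x0]) := o_eq d r hd ⟨s1, hx0⟩
  have hel : EdgeLiftable d r (t ++ [x0]) t := by
    have : EdgeLiftable d r (u ++ [x]) t := by
      rw [el_iff (by simp; omega)]
      exact h _ (List.drop_suffix _ _).isInfix (by simp; omega)
    intro v hv
    exact this v (by rwa [ho])
  have hc := ht.2.2.2 x0 hel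
  rw [← ho, o_eq d r hd huO] at hc
  have him : (fun w : List Q => w.take t.length) '' mOrbit d r (u ++ [x]) = mOrbit d r u := by
    ext w
    constructor
    · rintro ⟨_, ⟨s, rfl⟩, rfl⟩
      refine ⟨s, ?_⟩
      simp only
      rw [h_take, List.take_left' hu]
    · rintro ⟨s, rfl⟩
      refine ⟨_, ⟨s, rfl⟩, ?_⟩
      simp only
      rw [h_take, List.take_left' hu]
  have hinj := Set.injOn_of_ncard_image_eq (by rw [him, hc]) (o_fin d r (u ++ [x]))
  apply hinj ⟨s, rfl⟩ ⟨s', rfl⟩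
  simp only
  rw [h_take, h_take, List.take_left' hu, hs]

lemma det [Finite Q] (hd : MReversible d) {t : List Q} (ht : IsJungleTrunk d r t) (q : List Q)
    (u : List Q) (hu : u.length = t.length) (h : HJ d r t (u ++ q)) (s s' : List A)
    (hs : mdelW d r s u = mdelW d r s' u) :
    mdelW d r s (u ++ q) = mdelW d r s' (u ++ q) := by
  induction q generalizing u s s' with
  | nil => simpa using hs
  | cons x q ih =>
    have h1 := det_one (x := x) hd ht hu (h.mono ⟨[], q, by simp⟩) hs
    cases u with
    | nil => exact absurd (List.length_eq_zero_iff.1 hu.symm) ht.1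
    | cons a u =>
      have e : (a :: u) ++ x :: q = a :: ((u ++ [x]) ++ q) := by simp
      rw [e] at h ⊢
      rw [List.cons_append, h_cons, h_cons, List.cons.injEq] at h1
      rw [h_cons, h_cons, h1.1, ih (u ++ [x]) (by simpa using hu)
        (h.mono (List.suffix_cons _ _).isInfix) _ _ h1.2]

/-- powers of a word -/
def hpw (c : List Q) : ℕ → List Q
  | 0 => []
  | k + 1 => c ++ hpw c k

lemma hpw_add (c : List Q) (k l : ℕ) : hpw c (k + l) = hpw c k ++ hpw c l := by
  induction k with
  | zero => simp [hpw]
  | succ k ih => rw [Nat.add_right_comm]; simp [hpw, ih]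

lemma cyc [Finite Q] [Finite A] (hi : MInvertible r) (hd : MReversible d) {t : List Q}
    (ht : IsJungleTrunk d r t) (u c' : List Q) (hu : u.length = t.length)
    (h : HJ d r t (u ++ c' ++ u)) :
    ∃ k, HJ d r t (hpw (u ++ c') (k + 1) ++ u) ∧
      ∀ w, mrhoW d r (hpw (u ++ c') (k + 1)) w = w := by
  have huO : u ∈ mOrbit d r t := h u (List.suffix_append _ _).isInfix hu
  have hJ : ∀ k, HJ d r t (hpw (u ++ c') k ++ u) ∧ u <+: hpw (u ++ c') k ++ u := by
    intro k
    induction k with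
    | zero => exact ⟨by simpa [hpw] using HJ.of_mem huO, by simp [hpw]⟩
    | succ k ih =>
      obtain ⟨h1, q, hq⟩ := ih
      refine ⟨?_, by simp [hpw]⟩
      have : hpw (u ++ c') (k + 1) ++ u = (u ++ c') ++ u ++ q := by
        rw [List.append_assoc _ u q, hq]; simp [hpw]
      rw [this]
      rw [← hq] at h1
      exact HJ.glue hu h h1
  have : Finite {v : List Q // v.length = t.length} := List.finite_length_eq Q t.length
  let R : ℕ → Set ({v : List Q // v.length = t.length} × A × A) := fun k =>
    {p | ∃ s, mdelW d r s u = p.1.1 ∧ hout r (mdelW d r s (hpw (u ++ c') (k + 1))) p.2.1 = p.2.2}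
  have hsub : ∀ k l, R k = R l → ∀ w s, mrhoW d r (mdelW d r s (hpw (u ++ c') (k + 1))) w
      = mrhoW d r (mdelW d r s (hpw (u ++ c') (l + 1))) w := by
    intro k l hkl w
    induction w with
    | nil => intro s; rw [hr_nil, hr_nil]
    | cons i w ih =>
      intro s
      have hm : ((⟨mdelW d r s u, by rw [h_len, hu]⟩, i,
          hout r (mdelW d r s (hpw (u ++ c') (k + 1))) i) :
          {v : List Q // v.length = t.length} × A × A) ∈ R k := ⟨s, rfl, rfl⟩
      rw [hkl] at hm
      obtain ⟨s', h1, h2⟩ := hm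
      simp only at h1 h2
      have hdet : mdelW d r s' (hpw (u ++ c') (l + 1)) = mdelW d r s (hpw (u ++ c') (l + 1)) := by
        have e : hpw (u ++ c') (l + 1) = u ++ (c' ++ hpw (u ++ c') l) := by simp [hpw]
        rw [e]
        apply det hd ht _ u hu _ _ _ h1
        rw [← e]
        exact (hJ (l + 1)).1.mono (List.prefix_append _ _).isInfix
      rw [hdet] at h2
      have h3 := ih (s ++ [i])
      rw [h_comp, h_comp] at h3
      simp only [mdelW] at h3
      rw [hr_cons, hr_cons, h2, h3]
  obtain ⟨k, l, hne, hkl⟩ := Finite.exists_ne_map_eq_of_infinite R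
  have fin : ∀ k l, k < l → R k = R l → ∃ k, HJ d r t (hpw (u ++ c') (k + 1) ++ u) ∧
      ∀ w, mrhoW d r (hpw (u ++ c') (k + 1)) w = w := by
    intro k l hlt hkl
    obtain ⟨m, rfl⟩ : ∃ m, l = m + 1 + k := ⟨l - k - 1, by omega⟩
    refine ⟨m, (hJ _).1, fun w => ?_⟩
    have h1 := hsub _ _ hkl w []
    simp only [mdelW] at h1
    rw [Nat.add_assoc (m + 1), hpw_add _ (m + 1), hr_append] at h1
    exact (hr_inj d r hi _ h1).symm
  rcases lt_or_gt_of_ne hne with hh | hh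
  · exact fin k l hh hkl
  · exact fin l k hh hkl.symm

variable (d r) in
def HPath (t u v : List Q) : Prop := ∃ z, HJ d r t z ∧ u <+: z ∧ v <:+ z

lemma HPath.trans {t u v w : List Q} (hv : v.length = t.length) (h1 : HPath d r t u v)
    (h2 : HPath d r t v w) : HPath d r t u w := by
  obtain ⟨_, ha, hb, p, rfl⟩ := h1
  obtain ⟨_, hc, ⟨q, rfl⟩, he⟩ := h2
  refine ⟨p ++ v ++ q, HJ.glue hv ha hc, hb.trans (List.prefix_append _ _), he.trans ?_⟩
  exact ⟨p, by simp⟩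

lemma edge_back [Finite Q] (hi : MInvertible r) (hd : MReversible d) {t : List Q}
    (ht : IsJungleTrunk d r t) (a x : Q) (u0 : List Q) (hl : (a :: u0).length = t.length)
    (h : HJ d r t (a :: u0 ++ [x])) : HPath d r t (u0 ++ [x]) (a :: u0) := by
  have huO : (a :: u0) ∈ mOrbit d r t := h _ (List.prefix_append _ _).isInfix hl
  have hvO : (u0 ++ [x]) ∈ mOrbit d r t := h _ ⟨[a], [], by simp⟩ (by simpa using hl)
  let O := {v : List Q // v ∈ mOrbit d r t}
  have : Finite O := o_fin d r t
  have hex : ∀ v : O, ∃ v' : O, ∃ s, mdelW d r s (a :: u0) = v.1 ∧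
      mdelW d r (mrho d r a s) (u0 ++ [x]) = v'.1 := by
    rintro ⟨v, hv⟩
    rw [o_eq d r hd huO] at hv
    obtain ⟨s, hs⟩ := hv
    exact ⟨⟨_, o_trans d r hvO ⟨_, rfl⟩⟩, s, hs, rfl⟩
  choose σ hσ using hex
  have hdet : ∀ (v : O) s, mdelW d r s (a :: u0) = v.1 →
      mdelW d r (mrho d r a s) (u0 ++ [x]) = (σ v).1 := by
    intro v s hs
    obtain ⟨s', h1, h2⟩ := hσ v
    have := det hd ht [x] (a :: u0) hl h s s' (by rw [hs, h1])
    rw [List.cons_append, h_cons, h_cons, List.cons.injEq] at this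
    rw [this.2, h2]
  have hsurj : Function.Surjective σ := by
    rintro ⟨v, hv⟩
    have hv' := hv
    rw [o_eq d r hd hvO] at hv'
    obtain ⟨s0, hs0⟩ := hv'
    obtain ⟨s, rfl⟩ := hr_surj d r hi a s0
    refine ⟨⟨mdelW d r s (a :: u0), o_trans d r huO ⟨s, rfl⟩⟩, ?_⟩
    apply Subtype.ext
    rw [← hdet _ s rfl, hs0]
  have hinj : Function.Injective σ := Finite.injective_iff_surjective.2 hsurj
  have hstep : ∀ v : O, HPath d r t v.1 (σ v).1 := by
    intro v
    obtain ⟨s, h1, h2⟩ := hσ v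
    refine ⟨mdelW d r s (a :: u0 ++ [x]), ?_, ?_, ?_⟩
    · have e1 : mdelW d r s (a :: u0 ++ [x]) = hdq d s a :: (σ v).1 := by
        rw [List.cons_append, h_cons, h2]
      have e2 : ∃ y, mdelW d r s (a :: u0 ++ [x]) = v.1 ++ [y] := by
        rw [h_append, h1, h_cons, h_nil]; exact ⟨_, rfl⟩
      obtain ⟨y, e2⟩ := e2
      have lv := o_len d r v.2
      rintro f ⟨p, q, hf⟩ hfl
      rw [← hf] at e1 e2
      cases p with
      | nil =>
        have : f = v.1 := by
          refine (List.append_inj (t₁ := q) (t₂ := [y]) (by simpa using e2) (by omega)).1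
        rw [this]; exact v.2
      | cons b p =>
        simp only [List.cons_append, List.cons.injEq] at e1
        have : f = (σ v).1 := by
          apply List.IsInfix.eq_of_length ⟨p, q, e1.2⟩
          rw [hfl, o_len d r (σ v).2]
        rw [this]; exact (σ v).2
    · rw [h_append, h1]; exact List.prefix_append _ _
    · rw [List.cons_append, h_cons, h2]; exact List.suffix_cons _ _
  have hit : ∀ (m : ℕ) (v : O), HPath d r t v.1 (σ^[m] v).1 := by
    intro m
    induction m with
    | zero => intro v; exact ⟨v.1, HJ.of_mem v.2, List.prefix_refl _, List.suffix_refl _⟩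
    | succ m ih => intro v; exact (hstep v).trans (o_len d r (σ v).2) (ih (σ v))
  obtain ⟨k, hk, hp⟩ := hinj.mem_periodicPts ⟨a :: u0, huO⟩
  obtain ⟨k, rfl⟩ : ∃ m, k = m + 1 := ⟨k - 1, by omega⟩
  have h1 := hit k (σ ⟨a :: u0, huO⟩)
  have h2 : σ^[k] (σ ⟨a :: u0, huO⟩) = ⟨a :: u0, huO⟩ := hp
  rw [h2] at h1
  have h3 : u0 ++ [x] = (σ ⟨a :: u0, huO⟩).1 := hdet ⟨a :: u0, huO⟩ [] rfl
  rwa [← h3] at h1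

lemma HPath.symm [Finite Q] (hi : MInvertible r) (hd : MReversible d) {t : List Q}
    (ht : IsJungleTrunk d r t) {u v : List Q} (hu : u.length = t.length)
    (hv : v.length = t.length) (h : HPath d r t u v) : HPath d r t v u := by
  obtain ⟨_, hz, ⟨q, rfl⟩, hs⟩ := h
  induction q generalizing u with
  | nil =>
    rw [List.append_nil] at hs hz
    have := hs.isInfix.eq_of_length (by rw [hu, hv])
    subst this
    exact ⟨v, hz, List.prefix_refl _, List.suffix_refl _⟩
  | cons x q ih =>
    cases u with
    | nil => exact absurd (List.length_eq_zero_iff.1 hu.symm) ht.1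
    | cons a u =>
      have e : (a :: u) ++ x :: q = a :: ((u ++ [x]) ++ q) := by simp
      have hb := edge_back hi hd ht a x u hu (hz.mono ⟨[], q, by simp⟩)
      rw [e] at hz hs
      have hl : (u ++ [x]).length = t.length := by simpa using hu
      refine (ih hl (hz.mono (List.suffix_cons _ _).isInfix) ?_).trans hl hb
      apply List.suffix_of_suffix_length_le hs (List.suffix_cons _ _)
      simp at hu ⊢; omega

lemma ext_one [Finite Q] (hd : MReversible d) {t : List Q} (ht : IsJungleTrunk d r t)
    {u : List Q} (hu : u ∈ mOrbit d r t) : ∃ x, HJ d r t (u ++ [x]) := by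
  obtain ⟨x, -, -, hx, -⟩ := ht.2.2.1
  obtain ⟨s, rfl⟩ := hu
  have h1 : ∃ y, mdelW d r s (t ++ [x]) = mdelW d r s t ++ [y] := by
    rw [h_append, h_cons, h_nil]; exact ⟨_, rfl⟩
  obtain ⟨y, hy⟩ := h1
  refine ⟨y, ?_⟩
  rintro f ⟨p, q, hf⟩ hfl
  cases p with
  | nil =>
    have : f = mdelW d r s t :=
      (List.append_inj (t₁ := q) (t₂ := [y]) (by simpa using hf) (by rw [h_len, hfl])).1
    rw [this]; exact ⟨s, rfl⟩
  | cons b p =>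
    obtain ⟨v, hv, hs⟩ := hx _ ⟨s, hy⟩
    have hl := congrArg List.length hf
    simp [h_len] at hl
    have hq : q = [] := List.length_eq_zero_iff.1 (by omega)
    subst hq
    have : f <:+ mdelW d r s t ++ [y] := ⟨b :: p, by simpa using hf⟩
    have := List.suffix_of_suffix_length_le this hs (by rw [hfl, o_len d r hv])
    rw [this.isInfix.eq_of_length (by rw [hfl, o_len d r hv])]
    exact hv

lemma ext_n [Finite Q] (hd : MReversible d) {t : List Q} (ht : IsJungleTrunk d r t)
    (m : ℕ) {u : List Q} (hu : u ∈ mOrbit d r t) : ∃ e, e.length = m ∧ HJ d r t (u ++ e) := by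
  induction m generalizing u with
  | zero => exact ⟨[], rfl, by simpa using HJ.of_mem hu⟩
  | succ m ih =>
    obtain ⟨x, hx⟩ := ext_one hd ht hu
    have hul := o_len d r hu
    cases u with
    | nil => exact absurd (List.length_eq_zero_iff.1 hul.symm) ht.1
    | cons a u =>
      have hl : (u ++ [x]).length = t.length := by simpa using hul
      obtain ⟨e, he, hJ⟩ := ih (hx (u ++ [x]) ⟨[a], [], by simp⟩ hl)
      refine ⟨x :: e, by simp [he], ?_⟩
      have := HJ.glue (p := [a]) hl (by simpa using hx) hJ
      simpa using this

lemma long [Finite Q] (hi : MInvertible r) (hd : MReversible d) {t : List Q}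
    (ht : IsJungleTrunk d r t) {u v : List Q} (hu : u ∈ mOrbit d r t)
    (hv : v.length = t.length) (h : HPath d r t u v) : ∃ y, HJ d r t (u ++ y ++ v) := by
  obtain ⟨e, he, hJ⟩ := ext_n hd ht t.length hu
  have h1 : HPath d r t u e := ⟨_, hJ, List.prefix_append _ _, List.suffix_append _ _⟩
  have h2 := (h1.symm hi hd ht (o_len d r hu) he).trans (o_len d r hu) h
  obtain ⟨_, hz, ⟨q, rfl⟩, y, hy⟩ := h2
  refine ⟨y, ?_⟩
  have := HJ.glue he hJ hz
  rwa [List.append_assoc, ← hy, ← List.append_assoc] at this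

end helpers

/-- The relation `∼` is an equivalence relation on the set of stems. -/
theorem statement12 [Fintype Q] [Fintype A] [Nonempty Q] [Nonempty A]
    (d : A → Q → Q) (r : Q → A → A)
    (hbi : MBireversible d r) (hconn : MConnected d r)
    (hnab : ¬ HasActiveSelfLiftableBranch d r)
    (t : List Q) (ht : IsJungleTrunk d r t) :
    (∀ u : List Q, IsStem d r t u → StemEquiv d r t u u) ∧
    (∀ u v : List Q, IsStem d r t u → IsStem d r t v →
      StemEquiv d r t u v → StemEquiv d r t v u) ∧
    (∀ u v w : List Q, IsStem d r t u → IsStem d r t v → IsStem d r t w →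
      StemEquiv d r t u v → StemEquiv d r t v w → StemEquiv d r t u w) := by
  obtain ⟨hi, hd, -⟩ := hbi
  have hst : ∀ u, IsStem d r t u → u ∈ mOrbit d r t := by
    rintro u ⟨h, hl⟩
    have := h.1 t.length (by omega) le_rfl
    rwa [← hl, List.take_length, hl, List.take_length] at this
  refine ⟨?_, ?_, ?_⟩
  · rintro u hu
    have hO := hst u hu
    obtain ⟨y, hy⟩ := long hi hd ht hO hu.2
      ⟨u, HJ.of_mem hO, List.prefix_refl _, List.suffix_refl _⟩
    obtain ⟨k, h1, h2⟩ := cyc hi hd ht u y hu.2 hy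
    have e : hpw (u ++ y) (k + 1) = u ++ (y ++ hpw (u ++ y) k) := by simp [hpw]
    rw [e] at h1 h2
    exact ⟨_, (jword_iff (by simp [hu.2])).2 h1, h2⟩
  · rintro u v hu hv ⟨s, h1, h2⟩
    rw [jword_iff (by simp [hu.2])] at h1
    have hp : HPath d r t u v :=
      ⟨_, h1, by rw [List.append_assoc]; exact List.prefix_append _ _, List.suffix_append _ _⟩
    obtain ⟨y, hy⟩ := long hi hd ht (hst v hv) hu.2 (hp.symm hi hd ht hu.2 hv.2)
    rw [List.append_assoc] at hy
    have hg := HJ.glue hv.2 h1 hy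
    obtain ⟨k, h3, h4⟩ := cyc hi hd ht u (s ++ v ++ y) hu.2 (by simpa using hg)
    have e : hpw (u ++ (s ++ v ++ y)) (k + 1)
        = (u ++ s) ++ (v ++ (y ++ hpw (u ++ (s ++ v ++ y)) k)) := by simp [hpw]
    rw [e] at h3 h4
    refine ⟨y ++ hpw (u ++ (s ++ v ++ y)) k, (jword_iff (by simp [hv.2])).2 ?_, ?_⟩
    · refine h3.mono (List.IsSuffix.isInfix ⟨u ++ s, by simp⟩)
    · intro w
      have := h4 w
      rwa [hr_append, h2] at this
  · rintro u v w hu hv hw ⟨s, h1, h2⟩ ⟨s', h3, h4⟩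
    rw [jword_iff (by simp [hu.2])] at h1
    rw [jword_iff (by simp [hv.2]), List.append_assoc] at h3
    have hg := HJ.glue hv.2 h1 h3
    refine ⟨s ++ (v ++ s'), (jword_iff (by simp [hu.2])).2 (by simpa using hg), ?_⟩
    intro x
    rw [← List.append_assoc, hr_append, h2, h4]
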